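/- Let (X1, X2) be jointly Gaussian, mean-zero random variables with Var(X1) = Var(X2) = σ² > 0 and correlation ρ with |ρ| < 1, and let Y = β1·X1 + β2·X2 + ε, where ε is a mean-zero Gaussian random variable with variance σ_ε² independent of (X1, X2). Then the variable importance of X1, defined as VI₁ = E[(Y − E[Y | X2])²] − E[(Y − E[Y | X1, X2])²], satisfies VI₁ = β1²·(1 − ρ²)·σ². -/

import Mathlib

open MeasureTheory ProbabilityTheory


lemma vi_aux_law {Ω : Type*} [MeasurableSpace Ω] {μ : Measure Ω} [IsProbabilityMeasure μ]
    {f : Ω → ℝ} (hf : Measurable f) {v : ℝ} (hv : 0 ≤ v)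
    (h : Measure.map f μ = gaussianReal 0 v.toNNReal) :
    MemLp f 2 μ ∧ ∫ ω, f ω ∂μ = 0 ∧ ∫ ω, f ω ^ 2 ∂μ = v := by
  have h0 : ∫ ω, f ω ∂μ = 0 := by
    have := integral_id_gaussianReal (μ := 0) (v := v.toNNReal)
    rwa [← h, integral_map hf.aemeasurable (by fun_prop)] at this
  refine ⟨?_, h0, ?_⟩
  · have := memLp_id_gaussianReal' (μ := 0) (v := v.toNNReal) 2 (by simp)
    rwa [← h, memLp_map_measure_iff (by fun_prop) hf.aemeasurable] at this
  · have := variance_id_gaussianReal (μ := 0) (v := v.toNNReal)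
    rw [← h, variance_map (by fun_prop) hf.aemeasurable, Function.id_comp,
      variance_of_integral_eq_zero hf.aemeasurable h0, Real.coe_toNNReal _ hv] at this
    exact this

lemma vi_aux_condExp {Ω E : Type*} [MeasurableSpace Ω] [MeasurableSpace E] {μ : Measure Ω}
    [IsProbabilityMeasure μ] {f : Ω → ℝ} {X : Ω → E} (hf : Measurable f) (hX : Measurable X)
    (h0 : ∫ ω, f ω ∂μ = 0) (hi : IndepFun f X μ) :
    μ[f | MeasurableSpace.comap X inferInstance] =ᵐ[μ] fun _ => 0 := by
  have := condExp_indep_eq (μ := μ) (f := f) hf.comap_le hX.comap_le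
    (comap_measurable f).stronglyMeasurable hi
  rwa [h0] at this

lemma vi_aux_condExp_add {Ω E : Type*} [MeasurableSpace Ω] [MeasurableSpace E] {μ : Measure Ω}
    [IsProbabilityMeasure μ] {f : Ω → ℝ} {X : Ω → E} (u : E → ℝ) (hu : Measurable u)
    (hX : Measurable X) (hui : Integrable (fun ω => u (X ω)) μ) (hfi : Integrable f μ)
    (h : μ[f | MeasurableSpace.comap X inferInstance] =ᵐ[μ] fun _ => 0) :
    μ[(fun ω => u (X ω)) + f | MeasurableSpace.comap X inferInstance]
      =ᵐ[μ] fun ω => u (X ω) := by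
  have h1 := condExp_of_stronglyMeasurable (μ := μ) hX.comap_le
    (hu.comp (comap_measurable X)).stronglyMeasurable hui
  filter_upwards [condExp_add hui hfi (MeasurableSpace.comap X inferInstance), h] with ω h2 h3
  rw [h2, Pi.add_apply, h3, add_zero]
  exact congrFun h1 ω

/-- **Example 1.** For jointly Gaussian mean-zero `(X₁, X₂)` with common
variance `σ² > 0` and correlation `ρ`, `|ρ| < 1`, and `Y = β₁X₁ + β₂X₂ + ε` with `ε` a
mean-zero Gaussian independent of `(X₁, X₂)`, the variable importance of `X₁`,
`VI₁ = E[(Y − E[Y|X₂])²] − E[(Y − E[Y|X₁,X₂])²]`, equals `β₁²(1 − ρ²)σ²`. -/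
theorem vi_first_variable_linear_gaussian {Ωs : Type*} [MeasurableSpace Ωs]
    (μ : Measure Ωs) [IsProbabilityMeasure μ]
    (X1 X2 ε : Ωs → ℝ)
    (hX1 : Measurable X1) (hX2 : Measurable X2) (hε : Measurable ε)
    (σsq ρ β1 β2 σεsq : ℝ) (hσsq : 0 < σsq) (hρ : |ρ| < 1) (hσεsq : 0 ≤ σεsq)
    -- `(X₁, X₂)` is jointly Gaussian, mean-zero, with `Var(X₁) = Var(X₂) = σ²` and
    -- `Cov(X₁, X₂) = ρσ²`: every linear combination is a centered Gaussian
    (hgauss : ∀ a b : ℝ,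
      Measure.map (fun ω => a * X1 ω + b * X2 ω) μ
        = gaussianReal 0 ((a ^ 2 + b ^ 2) * σsq + 2 * a * b * ρ * σsq).toNNReal)
    -- `ε` is a mean-zero Gaussian with variance `σ_ε²`
    (hεlaw : Measure.map ε μ = gaussianReal 0 σεsq.toNNReal)
    -- `ε` is independent of `(X₁, X₂)`
    (hindep : IndepFun (fun ω => (X1 ω, X2 ω)) ε μ)
    (Y : Ωs → ℝ) (hY : Y = fun ω => β1 * X1 ω + β2 * X2 ω + ε ω) :
    (∫ ω, (Y ω - (μ[Y | MeasurableSpace.comap X2 inferInstance]) ω) ^ 2 ∂μ)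
      - (∫ ω, (Y ω
          - (μ[Y | MeasurableSpace.comap (fun ω => (X1 ω, X2 ω)) inferInstance]) ω) ^ 2 ∂μ)
      = β1 ^ 2 * (1 - ρ ^ 2) * σsq := by
  have hρ2 : ρ ^ 2 < 1 := by
    have := abs_lt.mp hρ
    nlinarith
  set Z : Ωs → ℝ := fun ω => X1 ω - ρ * X2 ω with hZdef
  have hZ : Measurable Z := by fun_prop
  have gauss : ∀ (f : Ωs → ℝ) (v a b : ℝ), f = (fun ω => a * X1 ω + b * X2 ω) →
      v = (a ^ 2 + b ^ 2) * σsq + 2 * a * b * ρ * σsq → 0 ≤ v →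
      MemLp f 2 μ ∧ ∫ ω, f ω ∂μ = 0 ∧ ∫ ω, f ω ^ 2 ∂μ = v := by
    intro f v a b hf hv hv0
    subst hf
    exact vi_aux_law (by fun_prop) hv0 (by rw [hv]; exact hgauss a b)
  obtain ⟨lZ, iZ, sZ⟩ := gauss Z ((1 - ρ ^ 2) * σsq) 1 (-ρ)
    (by funext ω; simp only [hZdef]; ring) (by ring) (by nlinarith)
  obtain ⟨lX, iX, sX⟩ := gauss X2 σsq 0 1 (by funext ω; ring) (by ring) hσsq.le
  obtain ⟨lS, iS, sS⟩ := gauss (fun ω => Z ω + X2 ω) ((2 - ρ ^ 2) * σsq) 1 (1 - ρ)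
    (by funext ω; simp only [hZdef]; ring) (by ring) (by nlinarith)
  obtain ⟨lε, iε, sε⟩ := vi_aux_law hε hσεsq hεlaw
  have lX1 : MemLp X1 2 μ := (gauss X1 σsq 1 0 (by funext ω; ring) (by ring) hσsq.le).1
  have jZ : Integrable Z μ := lZ.integrable (by norm_num)
  have jX : Integrable X2 μ := lX.integrable (by norm_num)
  have jX1 : Integrable X1 μ := lX1.integrable (by norm_num)
  have jε : Integrable ε μ := lε.integrable (by norm_num)
  have jZX : Integrable (fun ω => Z ω * X2 ω) μ := lZ.integrable_mul lX
  have jZε : Integrable (fun ω => Z ω * ε ω) μ := lZ.integrable_mul lε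
  have hZX : ∫ ω, Z ω * X2 ω ∂μ = 0 := by
    have e : (fun ω => (Z ω + X2 ω) ^ 2)
        = fun ω => (Z ω ^ 2 + X2 ω ^ 2) + 2 * (Z ω * X2 ω) := by funext ω; ring
    have j : Integrable (fun ω => Z ω ^ 2 + X2 ω ^ 2) μ := lZ.integrable_sq.add lX.integrable_sq
    rw [e, integral_add j (jZX.const_mul 2),
      integral_add lZ.integrable_sq lX.integrable_sq, integral_const_mul, sZ, sX] at sS
    linarith
  have hgl : HasGaussianLaw (fun ω => (Z ω, X2 ω)) μ := by
    refine ⟨isGaussian_of_map_eq_gaussianReal fun L => ?_⟩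
    have hm := hgauss (L (1, 0)) (L (0, 1) - ρ * L (1, 0))
    refine ⟨0, _, Eq.trans ?_ hm⟩
    · rw [Measure.map_map (by fun_prop) (by fun_prop)]
      congr 1
      funext ω
      have : ((Z ω, X2 ω) : ℝ × ℝ) = Z ω • ((1, 0) : ℝ × ℝ) + X2 ω • ((0, 1) : ℝ × ℝ) := by
        simp
      rw [Function.comp_apply, this, map_add, map_smul, map_smul]
      simp only [smul_eq_mul, hZdef]
      ring
  have indZX : IndepFun Z X2 μ := by
    apply hgl.indepFun_of_covariance_eq_zero
    rw [covariance_eq_sub lZ lX, iZ]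
    simpa using hZX
  have indZε : IndepFun Z ε μ :=
    hindep.comp (φ := fun p : ℝ × ℝ => p.1 - ρ * p.2) (ψ := id) (by fun_prop) measurable_id
  have indX2ε : IndepFun X2 ε μ :=
    hindep.comp (φ := fun p : ℝ × ℝ => p.2) (ψ := id) (by fun_prop) measurable_id
  have hZε : ∫ ω, Z ω * ε ω ∂μ = 0 := by
    have := indZε.integral_mul_eq_mul_integral lZ.1 lε.1
    rw [iZ, zero_mul] at this
    exact this
  -- conditional expectation given both variables
  have c12 : μ[Y | MeasurableSpace.comap (fun ω => (X1 ω, X2 ω)) inferInstance]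
      =ᵐ[μ] fun ω => β1 * X1 ω + β2 * X2 ω := by
    rw [hY]
    exact vi_aux_condExp_add (X := fun ω => (X1 ω, X2 ω)) (fun p : ℝ × ℝ => β1 * p.1 + β2 * p.2)
      (by fun_prop) (by fun_prop) ((jX1.const_mul β1).add (jX.const_mul β2)) jε
      (vi_aux_condExp hε (by fun_prop) iε hindep.symm)
  -- conditional expectation given the second variable
  have c2 : μ[Y | MeasurableSpace.comap X2 inferInstance]
      =ᵐ[μ] fun ω => (β1 * ρ + β2) * X2 ω := by
    have e : Y = (fun ω => (β1 * ρ + β2) * X2 ω) + ((fun ω => β1 * Z ω) + ε) := by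
      rw [hY]; funext ω; simp only [Pi.add_apply, hZdef]; ring
    rw [e]
    refine vi_aux_condExp_add (X := X2) (fun x : ℝ => (β1 * ρ + β2) * x)
      (by fun_prop) hX2 (jX.const_mul _) ((jZ.const_mul β1).add jε) ?_
    have a1 := vi_aux_condExp (f := fun ω => β1 * Z ω) (hZ.const_mul β1) hX2
      (by rw [integral_const_mul, iZ, mul_zero])
      (indZX.comp (φ := fun x : ℝ => β1 * x) (ψ := id) (by fun_prop) measurable_id)
    have a2 := vi_aux_condExp hε hX2 iε indX2ε.symm
    filter_upwards [condExp_add (jZ.const_mul β1) jε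
      (MeasurableSpace.comap X2 inferInstance), a1, a2] with ω h1 h2 h3
    rw [h1, Pi.add_apply, h2, h3, add_zero]
  have I12 : ∫ ω, (Y ω
      - (μ[Y | MeasurableSpace.comap (fun ω => (X1 ω, X2 ω)) inferInstance]) ω) ^ 2 ∂μ
      = σεsq := by
    rw [← sε]
    refine integral_congr_ae ?_
    filter_upwards [c12] with ω h
    rw [h, hY]; ring
  have I2 : ∫ ω, (Y ω - (μ[Y | MeasurableSpace.comap X2 inferInstance]) ω) ^ 2 ∂μ
      = β1 ^ 2 * ((1 - ρ ^ 2) * σsq) + σεsq := by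
    have : ∫ ω, (Y ω - (μ[Y | MeasurableSpace.comap X2 inferInstance]) ω) ^ 2 ∂μ
        = ∫ ω, (β1 ^ 2 * Z ω ^ 2 + ε ω ^ 2) + 2 * β1 * (Z ω * ε ω) ∂μ := by
      refine integral_congr_ae ?_
      filter_upwards [c2] with ω h
      rw [h, hY]; simp only [hZdef]; ring
    have j : Integrable (fun ω => β1 ^ 2 * Z ω ^ 2 + ε ω ^ 2) μ :=
      (lZ.integrable_sq.const_mul _).add lε.integrable_sq
    rw [this, integral_add j
      (jZε.const_mul _), integral_add (lZ.integrable_sq.const_mul _) lε.integrable_sq,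
      integral_const_mul, integral_const_mul, hZε, sZ, sε]
    ring
  rw [I12, I2]
  ring
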